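/- Let $X$ be a smooth projective Calabi-Yau variety with homogeneous coordinate ring $A$, let $\Phi: D^b(X) \to \underline{\mathrm{MCM}}_{\mathrm{gr}}(A)$ be Orlov's equivalence composed with Buchweitz's equivalence, and let $\sigma = \Phi^{-1} \circ (1) \circ \Phi$ be the endofunctor of $D^b(X)$ corresponding to the internal degree shift $(1)$ on graded MCM modules. Then for every graded maximal Cohen-Macaulay $A$-module $M$, the graded Betti numbers are given by $\beta_{i,j}(M) = \dim \mathrm{Hom}_{D^b(X)}(\Phi^{-1}(M), \sigma^{-j}(\Phi^{-1}(k^{st}))[i])$ for all $i, j \in \mathbb{Z}$. -/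

import Mathlib

open CategoryTheory Limits Pretriangulated

variable (k : Type) [Field k]

variable {D : Type} [Category.{0} D]

/-- iterated composition of the functor of an auto-equivalence -/
def eqPow (e : D ≌ D) : ℕ → D ⥤ D
  | 0 => 𝟭 D
  | n + 1 => e.functor ⋙ eqPow e n

/-- integer powers of an auto-equivalence -/
def eqZPow (e : D ≌ D) : ℤ → D ⥤ D
  | Int.ofNat n => eqPow e n
  | Int.negSucc n => eqPow e.symm (n + 1)

variable [Preadditive D] [Linear k D] [HasShift D ℤ]
variable {S : Type} [Category.{0} S] [Preadditive S] [Linear k S] [HasShift S ℤ]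

/-- A functor intertwining two auto-equivalences intertwines their iterates. -/
theorem nonempty_eqPow_comp_iso {C T : Type} [Category.{0} C] [Category.{0} T]
    (e : C ≌ C) (e' : T ≌ T) (F : C ⥤ T) (α : e.functor ⋙ F ≅ F ⋙ e'.functor) (n : ℕ) :
    Nonempty (eqPow e n ⋙ F ≅ F ⋙ eqPow e' n) := by
  induction n with
  | zero => exact ⟨F.leftUnitor ≪≫ F.rightUnitor.symm⟩
  | succ n ih =>
    obtain ⟨γ⟩ := ih
    exact ⟨Functor.associator _ _ _ ≪≫ Functor.isoWhiskerLeft e.functor γ ≪≫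
      (Functor.associator _ _ _).symm ≪≫ Functor.isoWhiskerRight α (eqPow e' n) ≪≫
      Functor.associator _ _ _⟩

/-- The conjugate of an auto-equivalence by an equivalence is intertwined with it. -/
def conjFunctorCompIso {C T : Type} [Category.{0} C] [Category.{0} T]
    (Φ : C ≌ T) (s : T ≌ T) :
    (Φ.trans (s.trans Φ.symm)).functor ⋙ Φ.functor ≅ Φ.functor ⋙ s.functor :=
  NatIso.ofComponents (fun X => Φ.counitIso.app (s.functor.obj (Φ.functor.obj X)))
    (fun f => Φ.counitIso.hom.naturality (s.functor.map (Φ.functor.map f)))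

/-- The inverse of a conjugate of an auto-equivalence is intertwined with the inverse. -/
def conjInverseCompIso {C T : Type} [Category.{0} C] [Category.{0} T]
    (Φ : C ≌ T) (s : T ≌ T) :
    (Φ.trans (s.trans Φ.symm)).symm.functor ⋙ Φ.functor ≅ Φ.functor ⋙ s.symm.functor :=
  NatIso.ofComponents (fun X => Φ.counitIso.app (s.inverse.obj (Φ.functor.obj X)))
    (fun f => Φ.counitIso.hom.naturality (s.inverse.map (Φ.functor.map f)))

/-- An equivalence intertwines integer powers of a conjugate with integer powers. -/
theorem nonempty_eqZPow_conj_comp_iso {C T : Type} [Category.{0} C] [Category.{0} T]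
    (Φ : C ≌ T) (s : T ≌ T) (n : ℤ) :
    Nonempty (eqZPow (Φ.trans (s.trans Φ.symm)) n ⋙ Φ.functor ≅ Φ.functor ⋙ eqZPow s n) := by
  cases n with
  | ofNat n => exact nonempty_eqPow_comp_iso _ _ _ (conjFunctorCompIso Φ s) n
  | negSucc n => exact nonempty_eqPow_comp_iso _ _ _ (conjInverseCompIso Φ s) (n + 1)

/-- The dimension of the morphisms out of the preimage of an object under a linear equivalence. -/
theorem finrank_hom_inverse_obj (K : Type) [Field K] {C T : Type} [Category.{0} C]
    [Category.{0} T] [Preadditive C] [Linear K C] [Preadditive T] [Linear K T]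
    (Φ : C ≌ T) [Φ.functor.Additive] [Φ.functor.Linear K] {M N : T} {X : C}
    (f : Φ.functor.obj X ≅ N) :
    Module.finrank K (Φ.inverse.obj M ⟶ X) = Module.finrank K (M ⟶ N) :=
  ((LinearEquiv.ofBijective (Φ.functor.mapLinearMap K)
    ⟨Φ.functor.map_injective, Φ.functor.map_surjective⟩).trans
    (Linear.homCongr K (Φ.counitIso.app M) f)).finrank_eq

/-- **the tautological formula for Betti numbers.**  Let `X` be a smooth
projective Calabi-Yau variety with homogeneous coordinate ring `A`, let
`Φ : D^b(X) ⥤ MCM(A)` be Orlov's equivalence composed with Buchweitz's equivalence and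
`σ = Φ⁻¹ ∘ (1) ∘ Φ`.  Then for every graded MCM module `M`,
`β_{i,j}(M) = dim Hom_{D^b(X)}(Φ⁻¹(M), σ^{-j}(Φ⁻¹(k^{st}))[i])` for all `i, j ∈ ℤ`.

Here `D` plays the role of `D^b(X)`, `S` of the stable category of graded MCM modules,
`s` of the internal degree shift `(1)`, `kst` of the stabilized residue field; the graded
Betti numbers of `M` are `β_{ij}(M) = dim Ext_stable^i(M, k^{st}(-j))`. -/
theorem betti_numbers_tautological_formula
    (s : S ≌ S) (Φ : D ≌ S) [Φ.functor.Additive] [Φ.functor.Linear k]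
    (hΦshift : ∀ n : ℤ, Φ.functor ⋙ shiftFunctor S n ≅ shiftFunctor D n ⋙ Φ.functor)
    (kst : S) (M : S)
    (β : ℤ → ℤ → ℕ)
    (hβ : ∀ i j : ℤ,
      β i j = Module.finrank k (M ⟶ ((eqZPow s (-j)).obj kst)⟦i⟧)) :
    ∀ i j : ℤ,
      β i j = Module.finrank k
        (Φ.inverse.obj M ⟶
          ((eqZPow (Φ.trans (s.trans Φ.symm)) (-j)).obj (Φ.inverse.obj kst))⟦i⟧) := by
  intro i j
  obtain ⟨γ⟩ := nonempty_eqZPow_conj_comp_iso Φ s (-j)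
  rw [hβ]
  exact (finrank_hom_inverse_obj k Φ
    (((hΦshift i).app _).symm ≪≫ (shiftFunctor S i).mapIso
      (γ.app (Φ.inverse.obj kst) ≪≫ (eqZPow s (-j)).mapIso (Φ.counitIso.app kst)))).symm
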